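/- Let ν > 0, 0 < α < T, and 0 ≤ d_min ≤ d be real numbers. With σ(s) = √(s² + ν⁻¹) for s ≥ 0 and σ_min = σ(d_min), one has 1 / (ν·(σ(d)·coth(σ(d)·α) + d)·(σ(d)·coth(σ(d)·(T − α)) + d)) ≤ 1 / (ν·(σ_min·coth(σ_min·α) + d_min)·(σ_min·coth(σ_min·(T − α)) + d_min)) < 1 / (ν·(σ_min + d_min)²). -/

import Mathlib

noncomputable def coth (x : ℝ) : ℝ := Real.cosh x / Real.sinh x

theorem sinh_convex_aux : ConvexOn ℝ (Set.Ici (0:ℝ)) Real.sinh := by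
  apply MonotoneOn.convexOn_of_deriv (convex_Ici 0) Real.continuous_sinh.continuousOn
    Real.differentiable_sinh.differentiableOn
  rw [Real.deriv_sinh]
  exact Real.cosh_strictMonoOn.monotoneOn.mono interior_subset

theorem sinh_aux {t s : ℝ} (ht : 0 ≤ t) (hs : 0 < s) (hts : t ≤ s) :
    s * Real.sinh t ≤ t * Real.sinh s := by
  have h1 : 0 ≤ 1 - t / s := by
    rw [sub_nonneg, div_le_one hs]; exact hts
  have h2 : 0 ≤ t / s := by positivity
  have h := sinh_convex_aux.2 (Set.mem_Ici.2 le_rfl) (Set.mem_Ici.2 hs.le) h1 h2 (by ring)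
  simp only [smul_eq_mul, mul_zero, zero_add, Real.sinh_zero, div_mul_cancel₀ _ hs.ne'] at h
  rw [div_mul_eq_mul_div, le_div_iff₀ hs] at h
  linarith

theorem xcoth_aux {x y : ℝ} (hx : 0 < x) (hxy : x ≤ y) : x * coth x ≤ y * coth y := by
  have h := sinh_aux (t := y - x) (s := y + x) (by linarith) (by linarith) (by linarith)
  rw [Real.sinh_sub, Real.sinh_add] at h
  unfold coth
  have h1 := Real.sinh_pos_iff.2 hx
  have h2 := Real.sinh_pos_iff.2 (hx.trans_le hxy)
  rw [← mul_div_assoc, ← mul_div_assoc, div_le_div_iff₀ h1 h2]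
  linarith

theorem xcoth_scaled_aux {x y a : ℝ} (ha : 0 < a) (hx : 0 < x) (hxy : x ≤ y) :
    x * coth (x * a) ≤ y * coth (y * a) := by
  have h := xcoth_aux (x := x * a) (y := y * a) (by positivity) (by gcongr)
  nlinarith

theorem one_lt_coth_aux {x : ℝ} (hx : 0 < x) : 1 < coth x := by
  unfold coth
  rw [one_lt_div (Real.sinh_pos_iff.2 hx)]
  exact Real.sinh_lt_cosh x

theorem sd1_factor_estimate (ν α T dmin d : ℝ) (hν : 0 < ν) (hα : 0 < α) (hαT : α < T)
    (hdmin : 0 ≤ dmin) (hd : dmin ≤ d) :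
    1 / (ν * (Real.sqrt (d ^ 2 + ν⁻¹) * coth (Real.sqrt (d ^ 2 + ν⁻¹) * α) + d) *
        (Real.sqrt (d ^ 2 + ν⁻¹) * coth (Real.sqrt (d ^ 2 + ν⁻¹) * (T - α)) + d)) ≤
      1 / (ν * (Real.sqrt (dmin ^ 2 + ν⁻¹) * coth (Real.sqrt (dmin ^ 2 + ν⁻¹) * α) + dmin) *
        (Real.sqrt (dmin ^ 2 + ν⁻¹) * coth (Real.sqrt (dmin ^ 2 + ν⁻¹) * (T - α)) + dmin)) ∧
      1 / (ν * (Real.sqrt (dmin ^ 2 + ν⁻¹) * coth (Real.sqrt (dmin ^ 2 + ν⁻¹) * α) + dmin) *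
        (Real.sqrt (dmin ^ 2 + ν⁻¹) * coth (Real.sqrt (dmin ^ 2 + ν⁻¹) * (T - α)) + dmin)) <
      1 / (ν * (Real.sqrt (dmin ^ 2 + ν⁻¹) + dmin) ^ 2) := by
  have hi : 0 < ν⁻¹ := inv_pos.2 hν
  have hx : 0 < Real.sqrt (dmin ^ 2 + ν⁻¹) := Real.sqrt_pos.2 (by positivity)
  have hxy : Real.sqrt (dmin ^ 2 + ν⁻¹) ≤ Real.sqrt (d ^ 2 + ν⁻¹) := by gcongr
  generalize Real.sqrt (dmin ^ 2 + ν⁻¹) = x at *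
  generalize Real.sqrt (d ^ 2 + ν⁻¹) = y at *
  have hb : 0 < T - α := sub_pos.2 hαT
  have a1 := xcoth_scaled_aux hα hx hxy
  have a2 := xcoth_scaled_aux hb hx hxy
  have b1 : x < x * coth (x * α) :=
    lt_mul_of_one_lt_right hx (one_lt_coth_aux (by positivity))
  have b2 : x < x * coth (x * (T - α)) :=
    lt_mul_of_one_lt_right hx (one_lt_coth_aux (by positivity))
  generalize x * coth (x * α) = p at *
  generalize x * coth (x * (T - α)) = q at *
  have hp : 0 < p + dmin := by linarith
  have hq : 0 < q + dmin := by linarith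
  constructor
  · apply one_div_le_one_div_of_le (by positivity)
    have hr : 0 ≤ y * coth (y * α) + d := by linarith
    gcongr
  · apply one_div_lt_one_div_of_lt (by positivity)
    rw [mul_assoc, sq]
    gcongr
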